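/- Let G be a connected graph with diameter d ≥ 2. Then ρ(ε(G)) = d if and only if G is a diametrical graph, i.e., every vertex of G has eccentricity d and has a unique vertex at distance d from it. -/

import Mathlib

open Finset SimpleGraph

variable {V : Type*}

/-- The eccentricity of a vertex: the largest distance to another vertex. -/
noncomputable def ecc [Fintype V] (G : SimpleGraph V) (u : V) : ℕ :=
  Finset.univ.sup fun v => G.dist u v

/-- The diameter of a graph: the largest eccentricity. -/
noncomputable def gdiam [Fintype V] (G : SimpleGraph V) : ℕ :=
  Finset.univ.sup fun u => ecc G u

/-- The eccentricity matrix: keep the distance `d(u,v)` if it equals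
`min (e u) (e v)`, and put `0` otherwise. -/
noncomputable def eccMatrix [Fintype V] (G : SimpleGraph V) : Matrix V V ℝ :=
  Matrix.of fun u v =>
    if G.dist u v = min (ecc G u) (ecc G v) then (G.dist u v : ℝ) else 0

/-- The distance matrix of a graph. -/
noncomputable def distMatrix [Fintype V] (G : SimpleGraph V) : Matrix V V ℝ :=
  Matrix.of fun u v => (G.dist u v : ℝ)

theorem Matrix.IsHermitian.posSemidef_algebraMap_sub {n : Type*} [Fintype n] [DecidableEq n]
    {A : Matrix n n ℝ} (hA : A.IsHermitian) {r : ℝ} (hr : ∀ i, hA.eigenvalues i ≤ r) :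
    (algebraMap ℝ (Matrix n n ℝ) r - A).PosSemidef := by
  have hB : (algebraMap ℝ (Matrix n n ℝ) r - A).IsHermitian := by
    refine Matrix.IsHermitian.sub ?_ hA
    rw [Matrix.algebraMap_eq_diagonal]
    exact Matrix.isHermitian_diagonal _
  rw [hB.posSemidef_iff_eigenvalues_nonneg]
  intro i
  have hi := hB.eigenvalues_mem_spectrum_real i
  rw [← spectrum.singleton_sub_eq, hA.spectrum_real_eq_range_eigenvalues] at hi
  obtain ⟨_, rfl, _, ⟨j, rfl⟩, h⟩ := hi
  rw [Pi.zero_apply, ← h]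
  exact sub_nonneg.mpr (hr j)

open scoped Matrix in
theorem Matrix.IsHermitian.apply_add_apply_eq_zero {n : Type*} [Fintype n] [DecidableEq n]
    {A : Matrix n n ℝ} (hA : A.IsHermitian) {r : ℝ} (hr : ∀ i, hA.eigenvalues i ≤ r)
    {u v w : n} (huv : u ≠ v) (huu : A u u = 0) (hvv : A v v = 0) (hAuv : A u v = r)
    (hwu : w ≠ u) (hwv : w ≠ v) : A w u + A w v = 0 := by
  have hAvu : A v u = r := by rw [← hAuv]; exact hA.apply u v
  set x : n → ℝ := Pi.single u 1 + Pi.single v 1 with hx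
  have hmul : ∀ z, ((algebraMap ℝ (Matrix n n ℝ) r - A) *ᵥ x) z = r * x z - (A z u + A z v) := by
    intro z
    rw [Matrix.sub_mulVec, Algebra.algebraMap_eq_smul_one, Matrix.smul_mulVec, Matrix.one_mulVec]
    simp [hx, Matrix.mulVec_add, mul_add]
  have hzero : (algebraMap ℝ (Matrix n n ℝ) r - A) *ᵥ x = 0 := by
    rw [← (hA.posSemidef_algebraMap_sub hr).dotProduct_mulVec_zero_iff, star_trivial]
    nth_rewrite 1 [hx]
    rw [add_dotProduct, single_dotProduct, single_dotProduct, hmul, hmul]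
    simp [hx, huv, huv.symm, huu, hvv, hAuv, hAvu]
  have h := hmul w
  rw [hzero] at h
  simp only [hx, Pi.zero_apply, Pi.add_apply, Pi.single_eq_of_ne hwu, Pi.single_eq_of_ne hwv] at h
  linarith

theorem dist_le_ecc [Fintype V] (G : SimpleGraph V) (u v : V) : G.dist u v ≤ ecc G u :=
  Finset.le_sup (f := fun v => G.dist u v) (mem_univ v)

theorem ecc_le_gdiam [Fintype V] (G : SimpleGraph V) (u : V) : ecc G u ≤ gdiam G :=
  Finset.le_sup (f := fun u => ecc G u) (mem_univ u)

theorem exists_dist_eq_ecc [Fintype V] (G : SimpleGraph V) (u : V) :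
    ∃ v, G.dist u v = ecc G u := by
  obtain ⟨v, -, h⟩ := Finset.exists_mem_eq_sup univ ⟨u, mem_univ u⟩ fun v => G.dist u v
  exact ⟨v, h.symm⟩

theorem exists_ecc_eq_gdiam [Fintype V] [Nonempty V] (G : SimpleGraph V) :
    ∃ u, ecc G u = gdiam G := by
  obtain ⟨u, -, h⟩ := Finset.exists_mem_eq_sup univ univ_nonempty fun u => ecc G u
  exact ⟨u, h.symm⟩

theorem eccMatrix_self [Fintype V] (G : SimpleGraph V) (u : V) : eccMatrix G u u = 0 := by
  simp [eccMatrix]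

theorem eccMatrix_nonneg [Fintype V] (G : SimpleGraph V) (u v : V) : 0 ≤ eccMatrix G u v := by
  simp only [eccMatrix, Matrix.of_apply]
  split_ifs <;> positivity

theorem dist_eq_zero_of_eccMatrix_eq_zero [Fintype V] {G : SimpleGraph V} {u v : V}
    (h : eccMatrix G u v = 0) (hd : G.dist u v = min (ecc G u) (ecc G v)) : G.dist u v = 0 := by
  simpa [eccMatrix, ← hd] using h

/-- If no `ε`-eigenvalue exceeds the diameter, then a diametral pair has no nonzero entry of the
eccentricity matrix in common with any other vertex. -/
theorem eccMatrix_eq_zero_of_dist_eq_gdiam [Fintype V] [DecidableEq V] {G : SimpleGraph V}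
    (hE : (eccMatrix G).IsHermitian) (hr : ∀ i, hE.eigenvalues i ≤ gdiam G) {u v w : V}
    (h0 : gdiam G ≠ 0) (huv : G.dist u v = gdiam G) (hwu : w ≠ u) (hwv : w ≠ v) :
    eccMatrix G w u = 0 ∧ eccMatrix G w v = 0 := by
  have hne : u ≠ v := by
    rintro rfl
    exact h0 (by rw [← huv, SimpleGraph.dist_self])
  have hu : ecc G u = gdiam G := (ecc_le_gdiam G u).antisymm (huv ▸ dist_le_ecc G u v)
  have hv : ecc G v = gdiam G :=
    (ecc_le_gdiam G v).antisymm (huv ▸ G.dist_comm (u := u) (v := v) ▸ dist_le_ecc G v u)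
  have hAuv : eccMatrix G u v = gdiam G := by simp [eccMatrix, huv, hu, hv]
  have hsum := hE.apply_add_apply_eq_zero hr hne (eccMatrix_self G u) (eccMatrix_self G v) hAuv
    hwu hwv
  exact (add_eq_zero_iff_of_nonneg (eccMatrix_nonneg G _ _) (eccMatrix_nonneg G _ _)).mp hsum

theorem diametrical_of_eigenvalues_le [Fintype V] [DecidableEq V] {G : SimpleGraph V}
    (hG : G.Connected) (h2 : 2 ≤ gdiam G) (hE : (eccMatrix G).IsHermitian)
    (hr : ∀ i, hE.eigenvalues i ≤ gdiam G) (u : V) :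
    ecc G u = gdiam G ∧ ∃! v : V, G.dist u v = gdiam G := by
  have hadj : ∀ a b, G.Adj a b → ecc G a = gdiam G → ecc G b = gdiam G := by
    intro a b hab ha
    obtain ⟨c, hc⟩ := exists_dist_eq_ecc G a
    rw [ha] at hc
    have hab1 : G.dist a b = 1 := SimpleGraph.dist_eq_one_iff_adj.mpr hab
    have htri := hG.dist_triangle (u := a) (v := b) (w := c)
    have hbc : b ≠ c := by
      rintro rfl
      omega
    have hzero := (eccMatrix_eq_zero_of_dist_eq_gdiam hE hr (by omega) hc hab.ne' hbc).2
    have h1 := dist_le_ecc G b c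
    have h3 := dist_le_ecc G c a
    rw [G.dist_comm, hc] at h3
    have hb := ecc_le_gdiam G b
    by_contra hne
    have := dist_eq_zero_of_eccMatrix_eq_zero hzero (by omega)
    omega
  have := hG.nonempty
  obtain ⟨a, ha⟩ := exists_ecc_eq_gdiam G
  have hecc : ∀ b, ecc G b = gdiam G := by
    intro b
    have hab := (SimpleGraph.reachable_iff_reflTransGen a b).mp (hG.preconnected a b)
    induction hab with
    | refl => exact ha
    | tail _ hbc ih => exact hadj _ _ hbc ih
  obtain ⟨v, hv⟩ := exists_dist_eq_ecc G u
  rw [hecc] at hv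
  refine ⟨hecc u, v, hv, fun w hw => ?_⟩
  by_contra hwv
  have hwu : w ≠ u := by
    rintro rfl
    rw [SimpleGraph.dist_self] at hw
    omega
  have hzero := (eccMatrix_eq_zero_of_dist_eq_gdiam hE hr (by omega) hv hwu hwv).1
  replace hw : G.dist w u = gdiam G := G.dist_comm.trans hw
  have := dist_eq_zero_of_eccMatrix_eq_zero hzero (by rw [hw, hecc, hecc, min_self])
  omega

theorem sum_eccMatrix_of_diametrical [Fintype V] {G : SimpleGraph V} {d : ℕ}
    (h : ∀ u : V, ecc G u = d ∧ ∃! v : V, G.dist u v = d) (u : V) :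
    ∑ v, eccMatrix G u v = d := by
  obtain ⟨v, hv, huniq⟩ := (h u).2
  rw [Finset.sum_eq_single v]
  · simp [eccMatrix, (h _).1, hv]
  · intro w _ hw
    have : G.dist u w ≠ d := fun hd => hw (huniq w hd)
    simp [eccMatrix, (h _).1, this]
  · simp

theorem Matrix.IsHermitian.iSup_eigenvalues_eq_of_sum_row {n : Type*} [Fintype n] [DecidableEq n]
    [Nonempty n] {A : Matrix n n ℝ} (hA : A.IsHermitian) {r : ℝ} (h0 : ∀ i j, 0 ≤ A i j)
    (hr : ∀ i, ∑ j, A i j = r) : ⨆ i, hA.eigenvalues i = r := by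
  have hle : ∀ i, hA.eigenvalues i ≤ r := by
    intro i
    have hi : Module.End.HasEigenvalue (Matrix.toLin' A) (hA.eigenvalues i) := by
      rw [Module.End.hasEigenvalue_iff_mem_spectrum, Matrix.spectrum_toLin']
      exact hA.eigenvalues_mem_spectrum_real i
    obtain ⟨k, hk⟩ := eigenvalue_mem_ball hi
    rw [Metric.mem_closedBall, Real.dist_eq] at hk
    have hsum : ∑ j ∈ univ.erase k, ‖A k j‖ = r - A k k := by
      rw [← hr k, ← Finset.sum_erase_add _ _ (mem_univ k), add_sub_cancel_right]
      exact Finset.sum_congr rfl fun j _ => Real.norm_of_nonneg (h0 k j)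
    linarith [(abs_le.mp hk).2]
  have hmem : r ∈ spectrum ℝ A := by
    rw [← Matrix.spectrum_toLin', ← Module.End.hasEigenvalue_iff_mem_spectrum]
    refine Module.End.hasEigenvalue_of_hasEigenvector (x := 1)
      (Module.End.hasEigenvector_iff.mpr ⟨Module.End.mem_eigenspace_iff.mpr ?_, one_ne_zero⟩)
    ext i
    simp [Matrix.mulVec, dotProduct, hr]
  rw [hA.spectrum_real_eq_range_eigenvalues] at hmem
  obtain ⟨i, hi⟩ := hmem
  refine (ciSup_le hle).antisymm ?_
  rw [← hi]
  exact le_ciSup (Set.finite_range hA.eigenvalues).bddAbove i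

/-- For a connected graph with diameter `d ≥ 2`, the ε-spectral radius
equals `d` if and only if the graph is diametrical: every vertex has eccentricity `d`
and a unique vertex at distance `d` from it. -/
theorem eccMatrix_spectralRadius_eq_diam_iff_diametrical [Fintype V] [DecidableEq V]
    (G : SimpleGraph V) (hG : G.Connected) (d : ℕ) (hd : gdiam G = d) (h2 : 2 ≤ d)
    (hE : (eccMatrix G).IsHermitian) :
    (⨆ i, hE.eigenvalues i) = (d : ℝ) ↔
      ∀ u : V, ecc G u = d ∧ ∃! v : V, G.dist u v = d := by
  subst hd
  have := hG.nonempty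
  constructor
  · intro h
    refine diametrical_of_eigenvalues_le hG h2 hE fun i => ?_
    rw [← h]
    exact le_ciSup (Set.finite_range hE.eigenvalues).bddAbove i
  · intro h
    exact hE.iSup_eigenvalues_eq_of_sum_row (eccMatrix_nonneg G) (sum_eccMatrix_of_diametrical h)
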